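/- arXiv:2603.23156 — 3 statements merged into one kernel-verified Lean document; each statement's English description precedes it below -/
import Mathlib

section
/- Let T > 0, δ, c_p, c_i ∈ ℝ, c_a > 0, ξ₀ ∈ ℝ, and let q : [0, T] → ℝ be continuous. Suppose ŷ : [0, T] → ℝ is differentiable with ŷ'(t) = δ·ŷ(t) + c_p − q(t) for all t ∈ [0, T] and ŷ(T) = 0. Set α̂(t) = (ŷ(t) − c_i)/(2c_a), and let x̂ : [0, T] → ℝ be differentiable with x̂'(t) = −δ·x̂(t) + α̂(t) and x̂(0) = ξ₀. Then for every continuous control α : [0, T] → ℝ and every differentiable x : [0, T] → ℝ with x'(t) = −δ·x(t) + α(t) and x(0) = ξ₀, the following identity holds: ∫_0^T [x(t)(q(t) − c_p) − c_i α(t) − c_a α(t)²] dt = ∫_0^T [x̂(t)(q(t) − c_p) − c_i α̂(t) − c_a α̂(t)²] dt − c_a ∫_0^T (α(t) − α̂(t))² dt. In particular, the total profit of any control α is at most that of α̂, with equality if and only if α(t) = α̂(t) for all t ∈ [0, T]. -/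
open intervalIntegral Set

/-- Deterministic Pontryagin verification: with adjoint `ŷ` solving the backward ODE and
`α̂ = (ŷ − c_i)/(2c_a)`, for every admissible control `α` and associated state `x`, the total
profit satisfies the completion-of-squares identity, hence `α̂` is optimal, with equality iff
`α = α̂` on `[0, T]`. -/
theorem pontryagin_verification (T δ c_p c_i c_a ξ₀ : ℝ) (hT : 0 < T) (hca : 0 < c_a)
    (q : ℝ → ℝ) (hq : ContinuousOn q (Set.Icc 0 T))
    (yhat : ℝ → ℝ)
    (hyhat : ∀ t ∈ Set.Icc (0:ℝ) T,
      HasDerivWithinAt yhat (δ * yhat t + c_p - q t) (Set.Icc 0 T) t)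
    (hyT : yhat T = 0)
    (αhat : ℝ → ℝ) (hαhat : ∀ t : ℝ, αhat t = (yhat t - c_i) / (2 * c_a))
    (xhat : ℝ → ℝ)
    (hxhat : ∀ t ∈ Set.Icc (0:ℝ) T,
      HasDerivWithinAt xhat (-δ * xhat t + αhat t) (Set.Icc 0 T) t)
    (hx0hat : xhat 0 = ξ₀) :
    ∀ α : ℝ → ℝ, ContinuousOn α (Set.Icc 0 T) →
    ∀ x : ℝ → ℝ,
      (∀ t ∈ Set.Icc (0:ℝ) T,
        HasDerivWithinAt x (-δ * x t + α t) (Set.Icc 0 T) t) →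
      x 0 = ξ₀ →
      ((∫ t in (0:ℝ)..T, (x t * (q t - c_p) - c_i * α t - c_a * (α t) ^ 2)) =
        (∫ t in (0:ℝ)..T, (xhat t * (q t - c_p) - c_i * αhat t - c_a * (αhat t) ^ 2))
          - c_a * ∫ t in (0:ℝ)..T, (α t - αhat t) ^ 2) ∧
      ((∫ t in (0:ℝ)..T, (x t * (q t - c_p) - c_i * α t - c_a * (α t) ^ 2)) ≤
        (∫ t in (0:ℝ)..T, (xhat t * (q t - c_p) - c_i * αhat t - c_a * (αhat t) ^ 2))) ∧
      (((∫ t in (0:ℝ)..T, (x t * (q t - c_p) - c_i * α t - c_a * (α t) ^ 2)) =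
        (∫ t in (0:ℝ)..T, (xhat t * (q t - c_p) - c_i * αhat t - c_a * (αhat t) ^ 2))) ↔
        ∀ t ∈ Set.Icc (0:ℝ) T, α t = αhat t) := by
  intro α hα x hx hx0
  have hyc : ContinuousOn yhat (Set.Icc 0 T) := fun t ht => (hyhat t ht).continuousWithinAt
  have hxc : ContinuousOn x (Set.Icc 0 T) := fun t ht => (hx t ht).continuousWithinAt
  have hxhc : ContinuousOn xhat (Set.Icc 0 T) := fun t ht => (hxhat t ht).continuousWithinAt
  have hαe : αhat = fun t => (yhat t - c_i) / (2 * c_a) := funext hαhat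
  have hαc : ContinuousOn αhat (Set.Icc 0 T) := by
    rw [hαe]
    exact (hyc.sub continuousOn_const).div_const _
  have hu : Set.uIcc 0 T = Set.Icc 0 T := Set.uIcc_of_le hT.le
  have hii : ∀ g : ℝ → ℝ, ContinuousOn g (Set.Icc 0 T) →
      IntervalIntegrable g MeasureTheory.volume 0 T := fun g hg =>
    ContinuousOn.intervalIntegrable (by rwa [hu])
  have hGc : ContinuousOn (fun t => (c_p - q t) * (x t - xhat t)
      + yhat t * (α t - αhat t)) (Set.Icc 0 T) := by fun_prop
  have hf1 : ContinuousOn (fun t => x t * (q t - c_p) - c_i * α t - c_a * (α t) ^ 2)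
      (Set.Icc 0 T) := by fun_prop
  have hf2 : ContinuousOn (fun t => xhat t * (q t - c_p) - c_i * αhat t - c_a * (αhat t) ^ 2)
      (Set.Icc 0 T) := by fun_prop
  have hf3 : ContinuousOn (fun t => (α t - αhat t) ^ 2) (Set.Icc 0 T) := by fun_prop
  have hG : (∫ t in (0:ℝ)..T, ((c_p - q t) * (x t - xhat t)
      + yhat t * (α t - αhat t))) = 0 := by
    have h := intervalIntegral.integral_eq_sub_of_hasDerivAt_of_le hT.le
      (f := fun t => yhat t * (x t - xhat t))
      (f' := fun t => (c_p - q t) * (x t - xhat t) + yhat t * (α t - αhat t))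
      (by fun_prop) (fun t ht => by
        have hm : t ∈ Set.Icc (0:ℝ) T := Set.Ioo_subset_Icc_self ht
        have hn : Set.Icc (0:ℝ) T ∈ nhds t := Icc_mem_nhds ht.1 ht.2
        have := ((hyhat t hm).hasDerivAt hn).mul
          (((hx t hm).hasDerivAt hn).sub ((hxhat t hm).hasDerivAt hn))
        refine this.congr_deriv ?_
        simp only [Pi.sub_apply]
        ring) (hii _ hGc)
    rw [h]
    simp [hyT, hx0, hx0hat]
  have key : (∫ t in (0:ℝ)..T, (x t * (q t - c_p) - c_i * α t - c_a * (α t) ^ 2)) =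
        (∫ t in (0:ℝ)..T, (xhat t * (q t - c_p) - c_i * αhat t - c_a * (αhat t) ^ 2))
          - c_a * ∫ t in (0:ℝ)..T, (α t - αhat t) ^ 2 := by
    rw [← intervalIntegral.integral_const_mul,
      ← intervalIntegral.integral_sub (hii _ hf2) ((hii _ hf3).const_mul c_a)]
    refine Eq.trans ?_ ((intervalIntegral.integral_sub
      ((hii _ hf2).sub ((hii _ hf3).const_mul c_a)) (hii _ hGc)).trans (by rw [hG, sub_zero]))
    refine intervalIntegral.integral_congr fun t _ => ?_
    have hy : yhat t = 2 * c_a * αhat t + c_i := by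
      rw [hαhat t]
      field_simp
      ring
    simp only [hy]
    ring
  have hnn : 0 ≤ ∫ t in (0:ℝ)..T, (α t - αhat t) ^ 2 :=
    intervalIntegral.integral_nonneg hT.le fun t _ => sq_nonneg _
  refine ⟨key, ?_, ?_, ?_⟩
  · rw [key]
    have := mul_nonneg hca.le hnn
    linarith
  · intro he t ht
    by_contra hne
    have hpos : 0 < ∫ t in (0:ℝ)..T, (α t - αhat t) ^ 2 :=
      intervalIntegral.integral_pos hT hf3 (fun _ _ => sq_nonneg _)
        ⟨t, ht, by have := sub_ne_zero.mpr hne; positivity⟩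
    have := mul_pos hca hpos
    linarith
  · intro hall
    have hz : (∫ t in (0:ℝ)..T, (α t - αhat t) ^ 2) = ∫ t in (0:ℝ)..T, (0:ℝ) :=
      intervalIntegral.integral_congr fun t ht => by
        rw [hu] at ht
        simp [hall t ht]
    rw [key, hz]
    simp
end

section
/- Let T > 0, δ > 0, c_a > 0, c_i, c_p, x₀ ∈ ℝ, and let P : [0, T] × ℝ → ℝ be continuous and such that for every t ∈ [0, T] the map x ↦ P(t, x) is nonincreasing. Suppose (x₁, y₁) and (x₂, y₂) are two pairs of differentiable functions [0, T] → ℝ satisfying, for i = 1, 2 and all t ∈ [0, T]: x_i'(t) = −δ·x_i(t) + (y_i(t) − c_i)/(2c_a), y_i'(t) = δ·y_i(t) + c_p − P(t, x_i(t)), with x_i(0) = x₀ and y_i(T) = 0. Then x₁ = x₂ and y₁ = y₂ on [0, T]. -/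
open Set

/-- Uniqueness for the two-point boundary value ODE system arising from the zero-noise
mean field game FBSDE: with `P(t, ·)` nonincreasing, two solutions of
`x' = −δx + (y − c_i)/(2c_a)`, `y' = δy + c_p − P(t, x)` with `x(0) = x₀`, `y(T) = 0`
coincide on `[0, T]`. -/
theorem fbsde_ode_uniqueness (T δ c_a c_i c_p x₀ : ℝ) (hT : 0 < T) (hδ : 0 < δ)
    (hca : 0 < c_a)
    (P : ℝ → ℝ → ℝ)
    (hPcont : ContinuousOn (fun p : ℝ × ℝ => P p.1 p.2) (Set.Icc 0 T ×ˢ Set.univ))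
    (hPmono : ∀ t ∈ Set.Icc (0:ℝ) T, Antitone (P t))
    (x₁ y₁ x₂ y₂ : ℝ → ℝ)
    (hx₁ : ∀ t ∈ Set.Icc (0:ℝ) T,
      HasDerivWithinAt x₁ (-δ * x₁ t + (y₁ t - c_i) / (2 * c_a)) (Set.Icc 0 T) t)
    (hy₁ : ∀ t ∈ Set.Icc (0:ℝ) T,
      HasDerivWithinAt y₁ (δ * y₁ t + c_p - P t (x₁ t)) (Set.Icc 0 T) t)
    (hx₂ : ∀ t ∈ Set.Icc (0:ℝ) T,
      HasDerivWithinAt x₂ (-δ * x₂ t + (y₂ t - c_i) / (2 * c_a)) (Set.Icc 0 T) t)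
    (hy₂ : ∀ t ∈ Set.Icc (0:ℝ) T,
      HasDerivWithinAt y₂ (δ * y₂ t + c_p - P t (x₂ t)) (Set.Icc 0 T) t)
    (hx₁0 : x₁ 0 = x₀) (hx₂0 : x₂ 0 = x₀) (hy₁T : y₁ T = 0) (hy₂T : y₂ T = 0) :
    ∀ t ∈ Set.Icc (0:ℝ) T, x₁ t = x₂ t ∧ y₁ t = y₂ t := by
  have hu : ∀ t ∈ Set.Icc (0:ℝ) T, HasDerivWithinAt (fun s => x₁ s - x₂ s)
      (-δ * (x₁ t - x₂ t) + (y₁ t - y₂ t) / (2 * c_a)) (Set.Icc 0 T) t := by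
    intro t ht
    refine ((hx₁ t ht).sub (hx₂ t ht)).congr_deriv ?_
    ring
  have hv : ∀ t ∈ Set.Icc (0:ℝ) T, HasDerivWithinAt (fun s => y₁ s - y₂ s)
      (δ * (y₁ t - y₂ t) - (P t (x₁ t) - P t (x₂ t))) (Set.Icc 0 T) t := by
    intro t ht
    refine ((hy₁ t ht).sub (hy₂ t ht)).congr_deriv ?_
    ring
  have huv : ∀ t ∈ Set.Icc (0:ℝ) T,
      HasDerivWithinAt (fun s => (x₁ s - x₂ s) * (y₁ s - y₂ s))
      ((y₁ t - y₂ t) ^ 2 / (2 * c_a) - (P t (x₁ t) - P t (x₂ t)) * (x₁ t - x₂ t))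
      (Set.Icc 0 T) t := by
    intro t ht
    refine ((hu t ht).mul (hv t ht)).congr_deriv ?_
    ring
  have hP : ∀ t ∈ Set.Icc (0:ℝ) T,
      (P t (x₁ t) - P t (x₂ t)) * (x₁ t - x₂ t) ≤ 0 := by
    intro t ht
    rcases le_total (x₁ t) (x₂ t) with h | h
    · have := hPmono t ht h
      exact mul_nonpos_of_nonneg_of_nonpos (by linarith) (by linarith)
    · have := hPmono t ht h
      exact mul_nonpos_of_nonpos_of_nonneg (by linarith) (by linarith)
  have h0 : (0:ℝ) ∈ Set.Icc (0:ℝ) T := ⟨le_rfl, hT.le⟩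
  have h1 : T ∈ Set.Icc (0:ℝ) T := ⟨hT.le, le_rfl⟩
  have hmono : MonotoneOn (fun s => (x₁ s - x₂ s) * (y₁ s - y₂ s)) (Set.Icc 0 T) := by
    refine monotoneOn_of_hasDerivWithinAt_nonneg (convex_Icc 0 T)
      (fun t ht => (huv t ht).continuousWithinAt)
      (fun t ht => (huv t (interior_subset ht)).mono interior_subset) ?_
    intro t ht
    have := hP t (interior_subset ht)
    have : 0 ≤ (y₁ t - y₂ t) ^ 2 / (2 * c_a) := by positivity
    linarith
  have hzero : ∀ t ∈ Set.Icc (0:ℝ) T, (x₁ t - x₂ t) * (y₁ t - y₂ t) = 0 := by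
    intro t ht
    have a := hmono h0 ht ht.1
    have b := hmono ht h1 ht.2
    simp only [hx₁0, hx₂0, hy₁T, hy₂T, sub_self, zero_mul, mul_zero] at a b
    exact le_antisymm b a
  have hv0 : ∀ t ∈ Set.Icc (0:ℝ) T, y₁ t - y₂ t = 0 := by
    intro t ht
    have hd : HasDerivWithinAt (fun s => (x₁ s - x₂ s) * (y₁ s - y₂ s)) 0 (Set.Icc 0 T) t :=
      (hasDerivWithinAt_const t (Set.Icc 0 T) (0:ℝ)).congr hzero (hzero t ht)
    have e := (uniqueDiffOn_Icc hT t ht).eq_deriv _ (huv t ht) hd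
    have := hP t ht
    have h2 : 0 ≤ (y₁ t - y₂ t) ^ 2 / (2 * c_a) := by positivity
    have h3 : (y₁ t - y₂ t) ^ 2 / (2 * c_a) = 0 := by linarith
    have h4 : (2 * c_a) ≠ 0 := by positivity
    rcases div_eq_zero_iff.mp h3 with h | h
    · exact pow_eq_zero_iff (two_ne_zero) |>.mp h
    · exact absurd h h4
  have hanti : AntitoneOn (fun s => (x₁ s - x₂ s) * (x₁ s - x₂ s)) (Set.Icc 0 T) := by
    refine antitoneOn_of_hasDerivWithinAt_nonpos (convex_Icc 0 T)
      (fun t ht => ((hu t ht).mul (hu t ht)).continuousWithinAt)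
      (fun t ht => ((hu t (interior_subset ht)).mul
        (hu t (interior_subset ht))).mono interior_subset) ?_
    intro t ht
    rw [hv0 t (interior_subset ht)]
    have := mul_nonneg hδ.le (mul_self_nonneg (x₁ t - x₂ t))
    simp only [zero_div]
    linarith
  intro t ht
  refine ⟨?_, sub_eq_zero.mp (hv0 t ht)⟩
  have a := hanti h0 ht ht.1
  simp only [hx₁0, hx₂0, sub_self, mul_zero] at a
  exact sub_eq_zero.mp (mul_self_eq_zero.mp (le_antisymm a (mul_self_nonneg _)))
end

section
/- Let T > 0, δ > 0, c_a > 0, c_i, c_p, x₀ ∈ ℝ, and let P : [0, T] × ℝ → ℝ be continuous, bounded, and Lipschitz in the second variable uniformly in the first. Then there exists a pair of differentiable functions x, y : [0, T] → ℝ satisfying, for all t ∈ [0, T]: x'(t) = −δ·x(t) + (y(t) − c_i)/(2c_a) and y'(t) = δ·y(t) + c_p − P(t, x(t)), with x(0) = x₀ and y(T) = 0. -/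
open Set

/-- Shooting lemma for a triangularly coupled, bounded, Lipschitz system. -/
theorem shooting_aux (T x₀ B C K : ℝ) (hT : 0 < T) (hB : 0 ≤ B) (hC : 0 ≤ C) (hK : 0 ≤ K)
    (g h : ℝ → ℝ → ℝ)
    (hgc : ∀ v, ContinuousOn (fun t => g t v) (Icc 0 T))
    (hhc : ∀ u, ContinuousOn (fun t => h t u) (Icc 0 T))
    (hgb : ∀ t ∈ Icc (0:ℝ) T, ∀ v, |g t v| ≤ B)
    (hhb : ∀ t ∈ Icc (0:ℝ) T, ∀ u, |h t u| ≤ C)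
    (hgl : ∀ t ∈ Icc (0:ℝ) T, ∀ v v', |g t v - g t v'| ≤ K * |v - v'|)
    (hhl : ∀ t ∈ Icc (0:ℝ) T, ∀ u u', |h t u - h t u'| ≤ K * |u - u'|) :
    ∃ u v : ℝ → ℝ,
      (∀ t ∈ Icc (0:ℝ) T, HasDerivWithinAt u (g t (v t)) (Icc 0 T) t) ∧
      (∀ t ∈ Icc (0:ℝ) T, HasDerivWithinAt v (h t (u t)) (Icc 0 T) t) ∧
      u 0 = x₀ ∧ v T = 0 ∧ ∀ t ∈ Icc (0:ℝ) T, |v t| ≤ 2 * (C * T) := by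
  have h0 : (0:ℝ) ∈ Icc 0 T := ⟨le_rfl, hT.le⟩
  have hTm : T ∈ Icc (0:ℝ) T := ⟨hT.le, le_rfl⟩
  have hCT : 0 ≤ C * T := by positivity
  let f : ℝ → ℝ × ℝ → ℝ × ℝ := fun t p => (g t p.2, h t p.1)
  have hf : IsPicardLindelof f (⟨0, h0⟩ : Icc (0:ℝ) T) (x₀, (0:ℝ))
      (⟨(B + C) * T + C * T, by positivity⟩ : NNReal) ⟨C * T, hCT⟩ ⟨B + C, by positivity⟩
      ⟨K, hK⟩ := by
    refine ⟨?_, ?_, ?_, ?_⟩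
    · intro t ht
      refine LipschitzOnWith.of_dist_le_mul fun p _ q _ => ?_
      rw [Prod.dist_eq, Prod.dist_eq]
      simp only [f, Real.dist_eq]
      refine max_le ((hgl t ht _ _).trans ?_) ((hhl t ht _ _).trans ?_)
      · exact mul_le_mul_of_nonneg_left (le_max_right _ _) hK
      · exact mul_le_mul_of_nonneg_left (le_max_left _ _) hK
    · intro p _
      exact (hgc p.2).prodMk (hhc p.1)
    · intro t ht p _
      rw [Prod.norm_def]
      simp only [f, Real.norm_eq_abs]
      have hb : B ≤ B + C := by linarith
      have hc : C ≤ B + C := by linarith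
      exact max_le ((hgb t ht _).trans hb) ((hhb t ht _).trans hc)
    · simp only [sub_zero, sub_self]
      rw [max_eq_left hT.le]
      change (B + C) * T ≤ (B + C) * T + C * T - C * T
      linarith
  obtain ⟨α, hα, L', hL⟩ := hf.exists_forall_mem_closedBall_eq_hasDerivWithinAt_lipschitzOnWith
  have hmem : ∀ η ∈ Icc (-(C * T)) (C * T),
      ((x₀, η) : ℝ × ℝ) ∈ Metric.closedBall (x₀, (0:ℝ)) (C * T) := by
    intro η hη
    rw [Metric.mem_closedBall, Prod.dist_eq]
    simp only [dist_self, Real.dist_eq, sub_zero]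
    exact max_le hCT (abs_le.mpr hη)
  have hder : ∀ η ∈ Icc (-(C * T)) (C * T), ∀ t ∈ Icc (0:ℝ) T,
      HasDerivWithinAt (fun s => (α (x₀, η) s).1) (g t (α (x₀, η) t).2) (Icc 0 T) t ∧
      HasDerivWithinAt (fun s => (α (x₀, η) s).2) (h t (α (x₀, η) t).1) (Icc 0 T) t := by
    intro η hη t ht
    have := (hα _ (hmem η hη)).2 t ht
    exact ⟨(ContinuousLinearMap.fst ℝ ℝ ℝ).hasFDerivAt.comp_hasDerivWithinAt t this,
      (ContinuousLinearMap.snd ℝ ℝ ℝ).hasFDerivAt.comp_hasDerivWithinAt t this⟩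
  have hini : ∀ η ∈ Icc (-(C * T)) (C * T), α (x₀, η) 0 = (x₀, η) := fun η hη =>
    (hα _ (hmem η hη)).1
  have hest : ∀ η ∈ Icc (-(C * T)) (C * T), ∀ t ∈ Icc (0:ℝ) T,
      |(α (x₀, η) t).2 - η| ≤ C * T := by
    intro η hη t ht
    have := Convex.norm_image_sub_le_of_norm_hasDerivWithin_le
      (fun t ht => (hder η hη t ht).2) (fun t ht => hhb t ht _) (convex_Icc 0 T) h0 ht
    simp only [hini η hη, Real.norm_eq_abs, sub_zero] at this
    refine this.trans (mul_le_mul_of_nonneg_left ?_ hC)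
    rw [abs_of_nonneg ht.1]; exact ht.2
  have hcont : ContinuousOn (fun η => (α (x₀, η) T).2) (Icc (-(C * T)) (C * T)) := by
    have h1 := (hL T hTm).continuousOn
    have h2 : ContinuousOn (fun η : ℝ => ((x₀, η) : ℝ × ℝ)) (Icc (-(C * T)) (C * T)) := by
      fun_prop
    exact continuous_snd.comp_continuousOn (h1.comp h2 hmem)
  have hle : -(C * T) ≤ C * T := by linarith
  obtain ⟨η, hη, hz⟩ : (0:ℝ) ∈ (fun η => (α (x₀, η) T).2) '' (Icc (-(C * T)) (C * T)) := by
    apply intermediate_value_Icc hle hcont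
    constructor
    · have := abs_le.mp (hest _ (left_mem_Icc.mpr hle) T hTm)
      show (α (x₀, -(C * T)) T).2 ≤ 0
      linarith [this.2]
    · have := abs_le.mp (hest _ (right_mem_Icc.mpr hle) T hTm)
      show 0 ≤ (α (x₀, C * T) T).2
      linarith [this.1]
  refine ⟨fun s => (α (x₀, η) s).1, fun s => (α (x₀, η) s).2, fun t ht => (hder η hη t ht).1,
    fun t ht => (hder η hη t ht).2, by simp [hini η hη], hz, fun t ht => ?_⟩
  have := abs_le.mp (hest η hη t ht)
  exact abs_le.mpr ⟨by linarith [this.1, hη.1], by linarith [this.2, hη.2]⟩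

/-- Existence for the two-point boundary value ODE system arising from the zero-noise
mean field game FBSDE: for `P` continuous, bounded, and Lipschitz in the second variable
uniformly in the first, there exists a pair `(x, y)` solving
`x' = −δx + (y − c_i)/(2c_a)`, `y' = δy + c_p − P(t, x)` with `x(0) = x₀`, `y(T) = 0`. -/
theorem fbsde_ode_existence (T δ c_a c_i c_p x₀ : ℝ) (hT : 0 < T) (hδ : 0 < δ)
    (hca : 0 < c_a)
    (P : ℝ → ℝ → ℝ)
    (hPcont : ContinuousOn (fun p : ℝ × ℝ => P p.1 p.2) (Set.Icc 0 T ×ˢ Set.univ))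
    (hPbdd : ∃ M : ℝ, ∀ t ∈ Set.Icc (0:ℝ) T, ∀ x : ℝ, |P t x| ≤ M)
    (hPlip : ∃ L : ℝ, 0 ≤ L ∧ ∀ t ∈ Set.Icc (0:ℝ) T, ∀ x x' : ℝ,
      |P t x - P t x'| ≤ L * |x - x'|) :
    ∃ x y : ℝ → ℝ,
      (∀ t ∈ Set.Icc (0:ℝ) T,
        HasDerivWithinAt x (-δ * x t + (y t - c_i) / (2 * c_a)) (Set.Icc 0 T) t) ∧
      (∀ t ∈ Set.Icc (0:ℝ) T,
        HasDerivWithinAt y (δ * y t + c_p - P t (x t)) (Set.Icc 0 T) t) ∧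
      x 0 = x₀ ∧ y T = 0 := by
  obtain ⟨M, hM⟩ := hPbdd
  obtain ⟨L, hL0, hL⟩ := hPlip
  have hM0 : 0 ≤ M := (abs_nonneg _).trans (hM 0 ⟨le_rfl, hT.le⟩ 0)
  set C : ℝ := |c_p| + M with hCdef
  have hC : 0 ≤ C := by positivity
  set R : ℝ := 2 * (C * T) with hR
  have hR0 : 0 ≤ R := by positivity
  set E : ℝ := Real.exp (δ * T) with hE
  have hE0 : 0 < E := Real.exp_pos _
  have hep : ∀ t ∈ Icc (0:ℝ) T, Real.exp (δ * t) ≤ E := fun t ht =>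
    Real.exp_le_exp.mpr (mul_le_mul_of_nonneg_left ht.2 hδ.le)
  have hem : ∀ t ∈ Icc (0:ℝ) T, Real.exp (-(δ * t)) ≤ 1 := fun t ht =>
    Real.exp_le_one_iff.mpr (by have := mul_nonneg hδ.le ht.1; linarith)
  let cl : ℝ → ℝ := fun v => max (-R) (min R v)
  have hclb : ∀ v, |cl v| ≤ R := fun v =>
    abs_le.mpr ⟨le_max_left _ _, max_le (by linarith) (min_le_left _ _)⟩
  have hcll : ∀ v v', |cl v - cl v'| ≤ |v - v'| := fun v v' =>
    (abs_max_sub_max_le_max _ _ _ _).trans (by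
      rw [sub_self, abs_zero, max_eq_right (abs_nonneg _)]
      refine (abs_min_sub_min_le_max _ _ _ _).trans ?_
      rw [sub_self, abs_zero, max_eq_right (abs_nonneg _)])
  have hcle : ∀ v, |v| ≤ R → cl v = v := fun v hv => by
    have := abs_le.mp hv
    show max (-R) (min R v) = v
    rw [min_eq_right this.2, max_eq_right this.1]
  let g : ℝ → ℝ → ℝ := fun t v =>
    Real.exp (δ * t) * ((Real.exp (δ * t) * cl v - c_i) / (2 * c_a))
  let h : ℝ → ℝ → ℝ := fun t u =>
    Real.exp (-(δ * t)) * (c_p - P t (Real.exp (-(δ * t)) * u))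
  obtain ⟨u, v, hu, hv, hu0, hvT, hvb⟩ := shooting_aux T x₀ (E * ((E * R + |c_i|) / (2 * c_a))) C
    (E * (E / (2 * c_a)) + L) hT (by positivity) hC (by positivity) g h
    (by intro v; apply Continuous.continuousOn; simp only [g]; fun_prop)
    (by
      intro u
      have h1 : ContinuousOn (fun t : ℝ => ((t, Real.exp (-(δ * t)) * u) : ℝ × ℝ)) (Icc 0 T) := by
        apply Continuous.continuousOn; fun_prop
      have h2 := hPcont.comp h1 (fun t ht => ⟨ht, mem_univ _⟩)
      have h3 : ContinuousOn (fun t : ℝ => Real.exp (-(δ * t))) (Icc 0 T) := by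
        apply Continuous.continuousOn; fun_prop
      exact h3.mul (continuousOn_const.sub h2))
    (by
      intro t ht v
      simp only [g]
      rw [abs_mul, abs_div, abs_of_pos (Real.exp_pos _), abs_of_pos (by positivity : 0 < 2 * c_a)]
      have h1 : |Real.exp (δ * t) * cl v - c_i| ≤ E * R + |c_i| := by
        refine (abs_sub _ _).trans ?_
        rw [abs_mul, abs_of_pos (Real.exp_pos _)]
        gcongr
        · exact hep t ht
        · exact hclb v
      gcongr
      exact hep t ht)
    (by
      intro t ht u
      simp only [h]
      rw [abs_mul, abs_of_pos (Real.exp_pos _)]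
      have h1 : |c_p - P t (Real.exp (-(δ * t)) * u)| ≤ C :=
        (abs_sub _ _).trans (by have := hM t ht (Real.exp (-(δ * t)) * u); linarith)
      calc _ ≤ 1 * C := by gcongr; exact hem t ht
        _ = C := one_mul _)
    (by
      intro t ht v v'
      have e : g t v - g t v' =
          Real.exp (δ * t) * (Real.exp (δ * t) / (2 * c_a)) * (cl v - cl v') := by
        simp only [g]; ring
      rw [e, abs_mul, abs_of_pos (by positivity)]
      have h1 := hcll v v'
      have h2 := hep t ht
      calc _ ≤ E * (E / (2 * c_a)) * |v - v'| := by gcongr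
        _ ≤ _ := by
          have := mul_nonneg hL0 (abs_nonneg (v - v'))
          linarith)
    (by
      intro t ht u u'
      have e : h t u - h t u' = Real.exp (-(δ * t)) *
          (P t (Real.exp (-(δ * t)) * u') - P t (Real.exp (-(δ * t)) * u)) := by
        simp only [h]; ring
      rw [e, abs_mul, abs_of_pos (Real.exp_pos _)]
      have h1 := hL t ht (Real.exp (-(δ * t)) * u') (Real.exp (-(δ * t)) * u)
      rw [← mul_sub, abs_mul, abs_of_pos (Real.exp_pos _), abs_sub_comm u' u] at h1
      have h2 := hem t ht
      have h4 : Real.exp (-(δ * t)) * |u - u'| ≤ 1 * |u - u'| := by gcongr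
      have h3 := mul_le_mul_of_nonneg_left h4 hL0
      have h5 : 0 ≤ E * (E / (2 * c_a)) * |u - u'| := by positivity
      calc _ ≤ 1 * |P t (Real.exp (-(δ * t)) * u') - P t (Real.exp (-(δ * t)) * u)| := by gcongr
        _ ≤ _ := by linarith)
  have hmul : ∀ t, Real.exp (-(δ * t)) * Real.exp (δ * t) = 1 := fun t => by
    rw [← Real.exp_add]; simp
  refine ⟨fun t => Real.exp (-(δ * t)) * u t, fun t => Real.exp (δ * t) * v t, ?_, ?_, ?_, ?_⟩
  · intro t ht
    have d1 : HasDerivWithinAt (fun t => Real.exp (-(δ * t))) (Real.exp (-(δ * t)) * -(δ * 1))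
        (Icc 0 T) t := (((hasDerivAt_id t).const_mul δ).neg.exp).hasDerivWithinAt
    refine (d1.mul (hu t ht)).congr_deriv ?_
    simp only [g, hcle _ (hvb t ht)]
    linear_combination ((Real.exp (δ * t) * v t - c_i) / (2 * c_a)) * hmul t
  · intro t ht
    have d1 : HasDerivWithinAt (fun t => Real.exp (δ * t)) (Real.exp (δ * t) * (δ * 1))
        (Icc 0 T) t := (((hasDerivAt_id t).const_mul δ).exp).hasDerivWithinAt
    refine (d1.mul (hv t ht)).congr_deriv ?_
    simp only [h]
    linear_combination (c_p - P t (Real.exp (-(δ * t)) * u t)) * hmul t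
  · simp [hu0]
  · simp [hvT]
end
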